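/- Let P and Q be two probability distributions. Then 1 − TV(P^n, Q^n) ≤ (1 − Hel²(P, Q))^n, where P^n denotes the n-fold product distribution. -/

import Mathlib

open MeasureTheory

/-- Total variation distance between two measures. -/
noncomputable def tvDist {Ω : Type*} [MeasurableSpace Ω] (P Q : Measure Ω) : ℝ :=
  ⨆ s : {s : Set Ω // MeasurableSet s}, |(P s.1).toReal - (Q s.1).toReal|

/-- Squared Hellinger distance between two measures. -/
noncomputable def sqHellinger {Ω : Type*} [MeasurableSpace Ω] (P Q : Measure Ω) : ℝ :=
  (1 / 2) * ∫ x, (Real.sqrt ((P.rnDeriv (P + Q)) x).toReal -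
      Real.sqrt ((Q.rnDeriv (P + Q)) x).toReal) ^ 2 ∂(P + Q)

lemma pi_real_eq {Ω : Type*} [MeasurableSpace Ω] (P μ : Measure Ω) [IsFiniteMeasure P]
    [IsFiniteMeasure μ] (p : Ω → ℝ) (hp : Integrable p μ) (h0 : ∀ x, 0 ≤ p x)
    (hP : P = μ.withDensity (fun x => ENNReal.ofReal (p x))) (n : ℕ) :
    (Measure.pi fun _ : Fin n => P) = (Measure.pi fun _ : Fin n => μ).withDensity
      (fun x => ENNReal.ofReal (∏ i, p (x i))) := by
  apply Measure.pi_eq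
  intro s hs
  rw [withDensity_apply _ (MeasurableSet.univ_pi hs), Measure.restrict_pi_pi,
    ← ofReal_integral_eq_lintegral_ofReal, integral_fintype_prod_eq_prod (fun _ => p),
    ENNReal.ofReal_prod_of_nonneg]
  · refine Finset.prod_congr rfl fun i _ => ?_
    rw [hP, withDensity_apply _ (hs i), ofReal_integral_eq_lintegral_ofReal hp.restrict
      (Filter.Eventually.of_forall h0)]
  · exact fun i _ => integral_nonneg h0
  · exact Integrable.fintype_prod (f := fun _ => p) fun i => hp.restrict
  · exact Filter.Eventually.of_forall fun x => Finset.prod_nonneg fun i _ => h0 _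

lemma toReal_eq {Ω : Type*} [MeasurableSpace Ω] (P μ : Measure Ω)
    (p : Ω → ℝ) (hp : Integrable p μ) (h0 : ∀ x, 0 ≤ p x)
    (hP : P = μ.withDensity (fun x => ENNReal.ofReal (p x))) (s : Set Ω) (hs : MeasurableSet s) :
    (P s).toReal = ∫ x in s, p x ∂μ := by
  rw [hP, withDensity_apply _ hs, ← ofReal_integral_eq_lintegral_ofReal hp.restrict
      (Filter.Eventually.of_forall h0), ENNReal.toReal_ofReal (integral_nonneg h0)]

lemma sub_le_tvDist {Ω : Type*} [MeasurableSpace Ω] (P Q : Measure Ω)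
    [IsProbabilityMeasure P] [IsProbabilityMeasure Q] (s : Set Ω) (hs : MeasurableSet s) :
    (P s).toReal - (Q s).toReal ≤ tvDist P Q := by
  refine (le_abs_self _).trans ?_
  refine le_ciSup (f := fun s : {s : Set Ω // MeasurableSet s} =>
    |(P s.1).toReal - (Q s.1).toReal|) ⟨1, ?_⟩ ⟨s, hs⟩
  rintro _ ⟨t, rfl⟩
  have h1 : (P t.1).toReal ≤ 1 := measureReal_le_one
  have h2 : (Q t.1).toReal ≤ 1 := measureReal_le_one
  have h3 : 0 ≤ (P t.1).toReal := ENNReal.toReal_nonneg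
  have h4 : 0 ≤ (Q t.1).toReal := ENNReal.toReal_nonneg
  exact abs_le.2 ⟨by linarith, by linarith⟩

lemma integrable_sqrt_mul {Ω : Type*} [MeasurableSpace Ω] (μ : Measure Ω)
    (p q : Ω → ℝ) (hp : Integrable p μ) (hq : Integrable q μ) (hp0 : ∀ x, 0 ≤ p x)
    (hq0 : ∀ x, 0 ≤ q x) : Integrable (fun x => √(p x) * √(q x)) μ := by
  refine (hp.add hq).mono' ((Real.continuous_sqrt.comp_aestronglyMeasurable hp.1).mul
    (Real.continuous_sqrt.comp_aestronglyMeasurable hq.1)) (Filter.Eventually.of_forall fun x => ?_)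
  rw [Real.norm_of_nonneg (by positivity)]
  simp only [Pi.add_apply]
  nlinarith [Real.sq_sqrt (hp0 x), Real.sq_sqrt (hq0 x), sq_nonneg (√(p x) - √(q x)), hp0 x, hq0 x]

lemma one_sub_tv_le {Ω : Type*} [MeasurableSpace Ω] (P Q μ : Measure Ω)
    [IsProbabilityMeasure P] [IsProbabilityMeasure Q] 
    (p q : Ω → ℝ) (hp : Integrable p μ) (hq : Integrable q μ) (hp0 : ∀ x, 0 ≤ p x)
    (hq0 : ∀ x, 0 ≤ q x) (mp : Measurable p) (mq : Measurable q)
    (hP : P = μ.withDensity (fun x => ENNReal.ofReal (p x)))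
    (hQ : Q = μ.withDensity (fun x => ENNReal.ofReal (q x))) :
    1 - tvDist P Q ≤ ∫ x, √(p x) * √(q x) ∂μ := by
  have hA : MeasurableSet {x | q x ≤ p x} := measurableSet_le mq mp
  have h1 := sub_le_tvDist P Q _ hA
  rw [toReal_eq P μ p hp hp0 hP _ hA, toReal_eq Q μ q hq hq0 hQ _ hA] at h1
  have h2 : ∫ x, p x ∂μ = 1 := by
    have := toReal_eq P μ p hp hp0 hP _ MeasurableSet.univ
    simpa using this.symm
  have hi := integrable_sqrt_mul μ p q hp hq hp0 hq0
  have h3 := integral_add_compl hA hp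
  have h4 := integral_add_compl hA hi
  have h5 : ∫ x in {x | q x ≤ p x}, q x ∂μ ≤ ∫ x in {x | q x ≤ p x}, √(p x) * √(q x) ∂μ := by
    refine setIntegral_mono_on hq.integrableOn hi.integrableOn hA fun x hx => ?_
    have hx' : √(q x) ≤ √(p x) := Real.sqrt_le_sqrt hx
    nlinarith [Real.mul_self_sqrt (hq0 x), Real.sqrt_nonneg (q x)]
  have h6 : ∫ x in {x | q x ≤ p x}ᶜ, p x ∂μ ≤ ∫ x in {x | q x ≤ p x}ᶜ, √(p x) * √(q x) ∂μ := by
    refine setIntegral_mono_on hp.integrableOn hi.integrableOn hA.compl fun x hx => ?_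
    have hx' : √(p x) ≤ √(q x) := Real.sqrt_le_sqrt (not_le.1 (show ¬ q x ≤ p x from hx)).le
    nlinarith [Real.mul_self_sqrt (hp0 x), Real.sqrt_nonneg (p x)]
  linarith

lemma density_eq {Ω : Type*} [MeasurableSpace Ω] (P μ : Measure Ω) [IsFiniteMeasure P]
    [IsFiniteMeasure μ] (h : P ≪ μ) :
    P = μ.withDensity (fun x => ENNReal.ofReal (P.rnDeriv μ x).toReal) := by
  conv_lhs => rw [← Measure.withDensity_rnDeriv_eq P μ h]
  refine withDensity_congr_ae ?_
  filter_upwards [Measure.rnDeriv_lt_top P μ] with x hx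
  rw [ENNReal.ofReal_toReal hx.ne]

/-- 1 − TV(P^n, Q^n) ≤ (1 − Hel²(P, Q))^n. -/
theorem one_sub_tv_pow {Ω : Type*} [MeasurableSpace Ω]
    (P Q : Measure Ω) [IsProbabilityMeasure P] [IsProbabilityMeasure Q] (n : ℕ) :
    1 - tvDist (Measure.pi fun _ : Fin n => P) (Measure.pi fun _ : Fin n => Q) ≤
      (1 - sqHellinger P Q) ^ n := by
  have hP := density_eq P (P + Q) (Measure.AbsolutelyContinuous.rfl.add_right Q)
  have hQ := density_eq Q (P + Q) (by
    rw [add_comm]; exact Measure.AbsolutelyContinuous.rfl.add_right P)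
  unfold sqHellinger
  have mp : Measurable fun x => (P.rnDeriv (P + Q) x).toReal :=
    (Measure.measurable_rnDeriv _ _).ennreal_toReal
  have mq : Measurable fun x => (Q.rnDeriv (P + Q) x).toReal :=
    (Measure.measurable_rnDeriv _ _).ennreal_toReal
  have ip : Integrable (fun x => (P.rnDeriv (P + Q) x).toReal) (P + Q) :=
    Measure.integrable_toReal_rnDeriv
  have iq : Integrable (fun x => (Q.rnDeriv (P + Q) x).toReal) (P + Q) :=
    Measure.integrable_toReal_rnDeriv
  have p0 : ∀ x, 0 ≤ (P.rnDeriv (P + Q) x).toReal := fun x => ENNReal.toReal_nonneg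
  have q0 : ∀ x, 0 ≤ (Q.rnDeriv (P + Q) x).toReal := fun x => ENNReal.toReal_nonneg
  have hfin : IsFiniteMeasure (P + Q) := inferInstance
  revert hP hQ mp mq ip iq p0 q0 hfin
  generalize hp : (fun x => (P.rnDeriv (P + Q) x).toReal) = p
  generalize hq : (fun x => (Q.rnDeriv (P + Q) x).toReal) = q
  have hp' : ∀ x, (P.rnDeriv (P + Q) x).toReal = p x := fun x => congrFun hp x
  have hq' : ∀ x, (Q.rnDeriv (P + Q) x).toReal = q x := fun x => congrFun hq x
  simp only [hp', hq']
  clear hp' hq' hp hq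
  generalize P + Q = μ
  intro hP hQ mp mq ip iq p0 q0 hfin
  have i := integrable_sqrt_mul μ p q ip iq p0 q0
  have h1 : 1 - 1 / 2 * ∫ x, (√(p x) - √(q x)) ^ 2 ∂μ = ∫ x, √(p x) * √(q x) ∂μ := by
    have e : ∀ x, (√(p x) - √(q x)) ^ 2 = p x + q x - 2 * (√(p x) * √(q x)) := fun x => by
      nlinarith [Real.sq_sqrt (p0 x), Real.sq_sqrt (q0 x)]
    have a : ∫ x, p x ∂μ = 1 := by
      have := toReal_eq P μ p ip p0 hP _ MeasurableSet.univ
      simpa using this.symm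
    have b : ∫ x, q x ∂μ = 1 := by
      have := toReal_eq Q μ q iq q0 hQ _ MeasurableSet.univ
      simpa using this.symm
    simp_rw [e]
    rw [integral_sub (f := fun x => p x + q x) (ip.add iq) (i.const_mul 2), integral_add ip iq, integral_const_mul, a, b]
    ring
  rw [h1]
  refine (one_sub_tv_le _ _ (Measure.pi fun _ : Fin n => μ) (fun x => ∏ i, p (x i))
    (fun x => ∏ i, q (x i)) (Integrable.fintype_prod (f := fun _ => p) fun i => ip)
    (Integrable.fintype_prod (f := fun _ => q) fun i => iq)
    (fun x => Finset.prod_nonneg fun i _ => p0 _) (fun x => Finset.prod_nonneg fun i _ => q0 _)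
    (by fun_prop) (by fun_prop) (pi_real_eq P μ p ip p0 hP n)
    (pi_real_eq Q μ q iq q0 hQ n)).trans ?_
  have e : ∀ x : Fin n → Ω, √(∏ i, p (x i)) * √(∏ i, q (x i)) = ∏ i, (√(p (x i)) * √(q (x i))) := by
    intro x
    rw [Finset.prod_mul_distrib, Real.sqrt_prod _ fun i _ => p0 _, Real.sqrt_prod _ fun i _ => q0 _]
  simp_rw [e]
  rw [integral_fintype_prod_eq_prod (fun _ x => √(p x) * √(q x))]
  simp
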